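/- arXiv:2406.17121 — 5 statements merged into one kernel-verified Lean document; each statement's English description precedes it below -/
import Mathlib

section
/- (Competitive ratio at the optimal threshold η* = √(β(1−T/C)).) Let C > 0, T ≥ 0, F ≥ 1 an integer flush period, p ∈ (0,1), τ > 0, and set β = τ/(pC). Assume β < 1 − T/C and T/C ≤ √(β(1−T/C)), and put η = √(β(1−T/C)). Then there is a constant c₀ ≥ 0 depending only on C, T, F, p, τ such that for every n and every transaction sequence tx of length n with maximum transaction size T, OPT_P(C,τ,p;tx) ≤ ((1−β)/(√(1−T/C) − √β)²) · (p·V_{A_η}(tx) − τ·f_{A_η}(tx)) + c₀. -/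
open Finset

noncomputable section

/-! ### The discrete `k`-wallet model -/

/-- Wallet `i` is offline at time `t`: some flush time `t' ∈ Φ i` satisfies `t' < t ≤ t' + F`. -/
def WalletOffline (F : ℕ) (Φ : ℕ → Finset ℕ) (i t : ℕ) : Prop :=
  ∃ t' ∈ Φ i, t' < t ∧ t ≤ t' + F

/-- A feasible execution in the discrete `k`-wallet model with integer flush period `F`,
total collateral `C` (each wallet has size `C / k`), over time slots `1,…,n`, on the
transaction sequence `tx`.  It consists of a settlement assignment
`s : ℕ → Option ℕ` (wallet indices are `0,…,k-1`) and flush-time sets `Φ i`.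
Whenever `s t = some i`, wallet `i` must be online at `t` and the total value settled in
wallet `i` since the wallet's last flush strictly before `t` (including `tx t`) is at
most `C / k`. -/
def DFeasible (F : ℕ) (C : ℝ) (k n : ℕ) (tx : ℕ → ℝ)
    (s : ℕ → Option ℕ) (Φ : ℕ → Finset ℕ) : Prop :=
  (∀ i, Φ i ⊆ Finset.Icc 1 n) ∧
  (∀ t i, s t = some i → i < k ∧ t ∈ Finset.Icc 1 n) ∧
  (∀ t i, s t = some i →
    ¬ WalletOffline F Φ i t ∧
    (∑ t' ∈ (Finset.Icc 1 t).filter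
        (fun t' => s t' = some i ∧ ∀ u ∈ Φ i, ¬ (t' ≤ u ∧ u < t)), tx t') ≤ C / k)

/-- The total value settled by an execution with settlement assignment `s`. -/
def DValue (n : ℕ) (tx : ℕ → ℝ) (s : ℕ → Option ℕ) : ℝ :=
  ∑ t ∈ (Finset.Icc 1 n).filter (fun t => (s t).isSome), tx t

/-! ### The `FlushAll` algorithm -/

/-- The state of the `FlushAll` algorithm: remaining wallet capacities, the time until which
all wallets are offline (inclusive), and the total value settled so far. -/
structure FAState where
  cap : ℕ → ℝ
  offlineUntil : ℕ
  settled : ℝ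

/-- One step of `FlushAll` (with `k` wallets of size `C / k` and flush period `F`) at time
`t` on a transaction of value `v`: if the wallets are offline, discard; else settle in the
least-index wallet that fits, if any; otherwise discard and flush all wallets. -/
def faStep (C : ℝ) (k F : ℕ) (st : FAState) (t : ℕ) (v : ℝ) : FAState :=
  if t ≤ st.offlineUntil then st
  else if h : ∃ i, i < k ∧ v ≤ st.cap i then
    let i := Nat.find h
    { st with cap := fun j => if j = i then st.cap i - v else st.cap j,
              settled := st.settled + v }
  else
    { cap := fun _ => C / k, offlineUntil := t + F, settled := st.settled }

/-- The state of `FlushAll` after processing `tx 1, …, tx n`. -/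
def faRun (C : ℝ) (k F n : ℕ) (tx : ℕ → ℝ) : FAState :=
  (List.range n).foldl (fun st j => faStep C k F st (j + 1) (tx (j + 1)))
    { cap := fun _ => C / k, offlineUntil := 0, settled := 0 }

/-- `V_FA(tx)`: the total value settled by `FlushAll`. -/
def VFA (C : ℝ) (k F n : ℕ) (tx : ℕ → ℝ) : ℝ := (faRun C k F n tx).settled

/-! ### The `FlushWhenFull` algorithm -/

/-- The state of `FlushWhenFull`: the active wallet's remaining capacity, a counter whose
value mod `k` is the active wallet, per-wallet offline deadlines, and the settled value. -/
structure FWFState where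
  cap : ℝ
  active : ℕ
  offlineUntil : ℕ → ℕ
  settled : ℝ

/-- One step of `FlushWhenFull` (with `k` wallets of size `C / k` and flush period `F`). -/
def fwfStep (C : ℝ) (k F : ℕ) (st : FWFState) (t : ℕ) (v : ℝ) : FWFState :=
  if t ≤ st.offlineUntil (st.active % k) then st
  else if v ≤ st.cap then { st with cap := st.cap - v, settled := st.settled + v }
  else
    { cap := C / k, active := st.active + 1,
      offlineUntil := fun j => if j = st.active % k then t + F else st.offlineUntil j,
      settled := st.settled }

/-- The state of `FlushWhenFull` after processing `tx 1, …, tx n`. -/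
def fwfRun (C : ℝ) (k F n : ℕ) (tx : ℕ → ℝ) : FWFState :=
  (List.range n).foldl (fun st j => fwfStep C k F st (j + 1) (tx (j + 1)))
    { cap := C / k, active := 0, offlineUntil := fun _ => 0, settled := 0 }

/-- `V_FWF(tx)`: the total value settled by `FlushWhenFull`. -/
def VFWF (C : ℝ) (k F n : ℕ) (tx : ℕ → ℝ) : ℝ := (fwfRun C k F n tx).settled

/-! ### The `FlushTwoWhenFull` algorithm -/

/-- The state of `FlushTwoWhenFull`: capacities of the two wallets of the active pair,
a counter whose value mod `k / 2` is the active pair, per-pair offline deadlines, and the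
settled value. -/
structure FTWFState where
  cap1 : ℝ
  cap2 : ℝ
  active : ℕ
  offlineUntil : ℕ → ℕ
  settled : ℝ

/-- One step of `FlushTwoWhenFull` (with `k` wallets of size `C / k`, grouped into `k / 2`
pairs, and flush period `F`). -/
def ftwfStep (C : ℝ) (k F : ℕ) (st : FTWFState) (t : ℕ) (v : ℝ) : FTWFState :=
  if t ≤ st.offlineUntil (st.active % (k / 2)) then st
  else if v ≤ st.cap1 then { st with cap1 := st.cap1 - v, settled := st.settled + v }
  else if v ≤ st.cap2 then { st with cap2 := st.cap2 - v, settled := st.settled + v }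
  else
    { cap1 := C / k, cap2 := C / k, active := st.active + 1,
      offlineUntil := fun j => if j = st.active % (k / 2) then t + F else st.offlineUntil j,
      settled := st.settled }

/-- The state of `FlushTwoWhenFull` after processing `tx 1, …, tx n`. -/
def ftwfRun (C : ℝ) (k F n : ℕ) (tx : ℕ → ℝ) : FTWFState :=
  (List.range n).foldl (fun st j => ftwfStep C k F st (j + 1) (tx (j + 1)))
    { cap1 := C / k, cap2 := C / k, active := 0, offlineUntil := fun _ => 0, settled := 0 }

/-- `V_FTWF(tx)`: the total value settled by `FlushTwoWhenFull`. -/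
def VFTWF (C : ℝ) (k F n : ℕ) (tx : ℕ → ℝ) : ℝ := (ftwfRun C k F n tx).settled

/-! ### The general collateral model -/

/-- A feasible settled set in the general collateral model with collateral `C` and flush
period `F`: for every `t ∈ S`, the total settled value in the window `[t - F, t]` is at
most `C`. -/
def GFeasible (F : ℕ) (C : ℝ) (n : ℕ) (tx : ℕ → ℝ) (S : Finset ℕ) : Prop :=
  S ⊆ Finset.Icc 1 n ∧
  ∀ t ∈ S, (∑ t' ∈ S.filter (fun t' => t - F ≤ t' ∧ t' ≤ t), tx t') ≤ C

/-- The total value of a settled set. -/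
def GValue (tx : ℕ → ℝ) (S : Finset ℕ) : ℝ := ∑ t ∈ S, tx t

/-! ### The threshold algorithm `A_η` -/

/-- The state of the threshold algorithm `A_η`: available collateral `avail`,
committed-but-unflushed collateral `committed`, total settled value, number of flushes
performed, and `ret u` is the amount of flushed collateral returning to availability at
time `u`. -/
structure EtaState where
  avail : ℝ
  committed : ℝ
  settled : ℝ
  flushes : ℕ
  ret : ℕ → ℝ

/-- One step of `A_η` (collateral `C`, threshold `η`, flush period `F`) at time `t` on a
transaction of value `v`: first any returning collateral is added back; the transaction is
settled iff the available collateral covers it; after settling, if the committed collateral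
reaches `η C`, exactly `η C` is flushed, returning at time `t + F + 1`. -/
def etaStep (C η : ℝ) (F : ℕ) (st : EtaState) (t : ℕ) (v : ℝ) : EtaState :=
  let U := st.avail + st.ret t
  if v ≤ U then
    if η * C ≤ st.committed + v then
      { avail := U - v, committed := st.committed + v - η * C,
        settled := st.settled + v, flushes := st.flushes + 1,
        ret := fun u => if u = t + F + 1 then st.ret u + η * C else st.ret u }
    else
      { avail := U - v, committed := st.committed + v,
        settled := st.settled + v, flushes := st.flushes, ret := st.ret }
  else { st with avail := U }

/-- The state of `A_η` after processing `tx 1, …, tx n`. -/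
def etaRun (C η : ℝ) (F n : ℕ) (tx : ℕ → ℝ) : EtaState :=
  (List.range n).foldl (fun st j => etaStep C η F st (j + 1) (tx (j + 1)))
    { avail := C, committed := 0, settled := 0, flushes := 0, ret := fun _ => 0 }

/-- `V_{A_η}(tx)`: the total value settled by the threshold algorithm `A_η`. -/
def VEta (C η : ℝ) (F n : ℕ) (tx : ℕ → ℝ) : ℝ := (etaRun C η F n tx).settled

/-- `f_{A_η}(tx)`: the number of flushes performed by the threshold algorithm `A_η`. -/
def fEta (C η : ℝ) (F n : ℕ) (tx : ℕ → ℝ) : ℕ := (etaRun C η F n tx).flushes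

/-! ### The general collateral model with profit margin and flush cost -/

/-- A feasible execution in the general collateral model with collateral `C` and flush
period `F`: a settled set `S ⊆ {1,…,n}` and a list `L` of flush events `(tⱼ, aⱼ)` with
`tⱼ ∈ {1,…,n}` and `aⱼ > 0`, such that (i) at every time `t` the total amount flushed by
time `t` is at most the total value settled by time `t`, and (ii) for every `t ∈ S` the
total value settled by time `t` minus the total amount whose flush period has completed
before `t` is at most `C`. -/
def PFeasible (F : ℕ) (C : ℝ) (n : ℕ) (tx : ℕ → ℝ) (S : Finset ℕ)
    (L : List (ℕ × ℝ)) : Prop :=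
  S ⊆ Finset.Icc 1 n ∧
  (∀ e ∈ L, e.1 ∈ Finset.Icc 1 n ∧ 0 < e.2) ∧
  (∀ t : ℕ, ((L.filter (fun e => decide (e.1 ≤ t))).map Prod.snd).sum ≤
      ∑ t' ∈ S.filter (fun t' => t' ≤ t), tx t') ∧
  (∀ t ∈ S, (∑ t' ∈ S.filter (fun t' => t' ≤ t), tx t')
      - ((L.filter (fun e => decide (e.1 + F < t))).map Prod.snd).sum ≤ C)

/-- The profit of an execution: `p · (total settled value) − τ · (number of flushes)`. -/
def PProfit (p τ : ℝ) (tx : ℕ → ℝ) (S : Finset ℕ) (L : List (ℕ × ℝ)) : ℝ :=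
  p * ∑ t ∈ S, tx t - τ * L.length

/-! ### Deterministic online 1-wallet algorithms -/

/-- A deterministic online 1-wallet algorithm: at each time `t` it decides, as a function
of the prefix `(tx 1, …, tx t)`, whether to settle `tx t` and whether to flush the wallet
at time `t`. -/
structure OnlineAlg where
  settles : List ℝ → Bool
  flushes : List ℝ → Bool

/-- The prefix `[tx 1, …, tx t]` of a transaction sequence. -/
def prefixList (tx : ℕ → ℝ) (t : ℕ) : List ℝ := (List.range t).map (fun j => tx (j + 1))

/-- The settlement assignment induced by a deterministic online 1-wallet algorithm. -/
def inducedS (A : OnlineAlg) (n : ℕ) (tx : ℕ → ℝ) : ℕ → Option ℕ := fun t =>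
  if t ∈ Finset.Icc 1 n ∧ A.settles (prefixList tx t) then some 0 else none

/-- The flush-time sets induced by a deterministic online 1-wallet algorithm. -/
def inducedPhi (A : OnlineAlg) (n : ℕ) (tx : ℕ → ℝ) : ℕ → Finset ℕ := fun _ =>
  (Finset.Icc 1 n).filter (fun t => A.flushes (prefixList tx t))

/-- `V_A(tx)`: the total value settled by the online algorithm `A` on `tx`. -/
def VOnline (A : OnlineAlg) (n : ℕ) (tx : ℕ → ℝ) : ℝ := DValue n tx (inducedS A n tx)

end
/-! ### Invariants of the threshold algorithm -/

theorem etaRun_zero (C η : ℝ) (F : ℕ) (tx : ℕ → ℝ) :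
    etaRun C η F 0 tx =
      { avail := C, committed := 0, settled := 0, flushes := 0, ret := fun _ => 0 } := rfl

theorem etaRun_succ (C η : ℝ) (F m : ℕ) (tx : ℕ → ℝ) :
    etaRun C η F (m + 1) tx = etaStep C η F (etaRun C η F m tx) (m + 1) (tx (m + 1)) := by
  simp [etaRun, List.range_succ]

theorem etaRun_committed_add (C η : ℝ) (F : ℕ) (tx : ℕ → ℝ) (m : ℕ) :
    (etaRun C η F m tx).committed + η * C * fEta C η F m tx = VEta C η F m tx := by
  unfold fEta VEta
  induction m with
  | zero => simp [etaRun_zero]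
  | succ m ih =>
    rw [etaRun_succ]
    unfold etaStep
    dsimp only
    split_ifs
    · push_cast
      linarith
    · dsimp only
      linarith
    · exact ih

theorem etaRun_committed_mem {C η T : ℝ} (F : ℕ) {tx : ℕ → ℝ} {n : ℕ}
    (hηC : 0 < η * C) (hT : T ≤ η * C)
    (htx : ∀ t ∈ Finset.Icc 1 n, 0 ≤ tx t ∧ tx t ≤ T) {m : ℕ} (hm : m ≤ n) :
    0 ≤ (etaRun C η F m tx).committed ∧ (etaRun C η F m tx).committed < η * C := by
  induction m with
  | zero => simpa [etaRun_zero] using hηC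
  | succ m ih =>
    obtain ⟨h0, h1⟩ := ih (by omega)
    obtain ⟨hv0, hvT⟩ := htx (m + 1) (Finset.mem_Icc.2 ⟨by omega, hm⟩)
    rw [etaRun_succ]
    unfold etaStep
    dsimp only
    split_ifs <;> dsimp only <;> constructor <;> linarith

theorem etaRun_ret (C η : ℝ) (F : ℕ) (tx : ℕ → ℝ) (m u : ℕ) :
    (etaRun C η F m tx).ret u =
      if u ≤ m + F + 1 then
        η * C * ((fEta C η F (u - F - 1) tx : ℝ) - fEta C η F (u - F - 2) tx)
      else 0 := by
  induction m with
  | zero =>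
    have h : u ≤ 0 + F + 1 → u - F - 1 = 0 ∧ u - F - 2 = 0 := by omega
    split_ifs with hu
    · simp [etaRun_zero, h hu]
    · simp [etaRun_zero]
  | succ m ih =>
    have hstep : (etaRun C η F (m + 1) tx).ret u = (etaRun C η F m tx).ret u +
        if u = m + 1 + F + 1 then
          η * C * ((fEta C η F (m + 1) tx : ℝ) - fEta C η F m tx) else 0 := by
      unfold fEta
      rw [etaRun_succ]
      unfold etaStep
      dsimp only
      split_ifs <;> simp_all
    rw [hstep, ih]
    by_cases hu : u = m + 1 + F + 1
    · have h1 : u - F - 1 = m + 1 := by omega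
      have h2 : u - F - 2 = m := by omega
      rw [if_neg (by omega), if_pos hu, if_pos (by omega), h1, h2, zero_add]
    · rw [if_neg hu, add_zero]
      exact if_congr (by omega) rfl rfl

theorem etaRun_avail (C η : ℝ) (F : ℕ) (tx : ℕ → ℝ) (m : ℕ) :
    (etaRun C η F m tx).avail =
      C - VEta C η F m tx + η * C * fEta C η F (m - F - 1) tx := by
  induction m with
  | zero => simp [fEta, VEta, etaRun_zero]
  | succ m ih =>
    have hstep : (etaRun C η F (m + 1) tx).avail = (etaRun C η F m tx).avail
        + (etaRun C η F m tx).ret (m + 1) - (VEta C η F (m + 1) tx - VEta C η F m tx) := by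
      unfold VEta
      rw [etaRun_succ]
      unfold etaStep
      dsimp only
      split_ifs <;> simp
    have h : m + 1 - F - 2 = m - F - 1 := by omega
    rw [hstep, ih, etaRun_ret, if_pos (by omega), h]
    ring

/-- Each step either settles the transaction or discards it, in which case the value
settled and the amount returned do not leave enough collateral to cover it. -/
theorem VEta_succ (C η : ℝ) (F : ℕ) (tx : ℕ → ℝ) (m : ℕ) :
    VEta C η F (m + 1) tx = VEta C η F m tx + tx (m + 1) ∨
      (VEta C η F (m + 1) tx = VEta C η F m tx ∧
        C - VEta C η F m tx + η * C * fEta C η F (m - F) tx < tx (m + 1)) := by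
  have hU : (etaRun C η F m tx).avail + (etaRun C η F m tx).ret (m + 1) =
      C - VEta C η F m tx + η * C * fEta C η F (m - F) tx := by
    have h1 : m + 1 - F - 1 = m - F := by omega
    have h2 : m + 1 - F - 2 = m - F - 1 := by omega
    rw [etaRun_avail, etaRun_ret, if_pos (by omega), h1, h2]
    ring
  rw [← hU]
  unfold VEta
  rw [etaRun_succ]
  unfold etaStep
  dsimp only
  split_ifs with h
  · exact Or.inl rfl
  · exact Or.inl rfl
  · exact Or.inr ⟨rfl, not_le.1 h⟩

/-! ### Bounds on feasible executions -/

theorem sum_filter_snd_mono {L : List (ℕ × ℝ)} (hL : ∀ e ∈ L, 0 < e.2)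
    {P Q : ℕ × ℝ → Bool} (hPQ : ∀ e, P e → Q e) :
    ((L.filter P).map Prod.snd).sum ≤ ((L.filter Q).map Prod.snd).sum := by
  refine ((List.monotone_filter_right L hPQ).map Prod.snd).sum_le_sum ?_
  simp only [List.mem_map, List.mem_filter, forall_exists_index, and_imp]
  rintro _ e he - rfl
  exact (hL e he).le

theorem sum_filter_snd_nonneg {L : List (ℕ × ℝ)} (hL : ∀ e ∈ L, 0 < e.2)
    (P : ℕ × ℝ → Bool) : 0 ≤ ((L.filter P).map Prod.snd).sum := by
  simpa using sum_filter_snd_mono hL (P := fun _ => false) (Q := P) (by simp)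

theorem add_sum_filter_snd_le {L : List (ℕ × ℝ)} (hL : ∀ e ∈ L, 0 < e.2)
    {P Q : ℕ × ℝ → Bool} (hPQ : ∀ e, P e → Q e) {e : ℕ × ℝ} (he : e ∈ L)
    (hP : P e = false) (hQ : Q e = true) :
    e.2 + ((L.filter P).map Prod.snd).sum ≤ ((L.filter Q).map Prod.snd).sum := by
  obtain ⟨l₁, l₂, rfl⟩ := List.append_of_mem he
  have h1 := sum_filter_snd_mono (L := l₁) (fun x hx => hL x (by simp [hx])) hPQ
  have h2 := sum_filter_snd_mono (L := l₂) (fun x hx => hL x (by simp [hx])) hPQ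
  simp only [List.filter_append, List.filter_cons, hP, hQ, List.map_append, List.sum_append,
    List.map_cons, List.sum_cons, if_true, Bool.false_eq_true, if_false]
  linarith

section Feasible

variable {F n : ℕ} {C : ℝ} {tx : ℕ → ℝ} {S : Finset ℕ} {L : List (ℕ × ℝ)}

theorem PFeasible.settled_le (h : PFeasible F C n tx S L) (hC : 0 ≤ C) (t : ℕ) :
    ∑ t' ∈ S.filter (fun t' => t' ≤ t), tx t' ≤
      C + ((L.filter (fun e => decide (e.1 + F < t))).map Prod.snd).sum := by
  obtain ⟨-, hL, -, hcap⟩ := h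
  have hpos : ∀ e ∈ L, 0 < e.2 := fun e he => (hL e he).2
  rcases (S.filter (fun t' => t' ≤ t)).eq_empty_or_nonempty with he | hne
  · rw [he, Finset.sum_empty]
    exact add_nonneg hC (sum_filter_snd_nonneg hpos _)
  · obtain ⟨s, hs, hmax⟩ := (S.filter (fun t' => t' ≤ t)).exists_max_image id hne
    obtain ⟨hsS, hst⟩ := Finset.mem_filter.1 hs
    have heq : S.filter (fun t' => t' ≤ t) = S.filter (fun t' => t' ≤ s) := by
      refine Finset.filter_congr fun x hx => ⟨fun hxt => ?_, fun hxs => hxs.trans hst⟩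
      exact hmax x (Finset.mem_filter.2 ⟨hx, hxt⟩)
    have hmono := sum_filter_snd_mono hpos (P := fun e => decide (e.1 + F < s))
      (Q := fun e => decide (e.1 + F < t))
      (fun e he => by simp only [decide_eq_true_eq] at he ⊢; omega)
    rw [heq]
    linarith [hcap s hsS]

theorem PFeasible.settled_window_le (h : PFeasible F C n tx S L) (hC : 0 ≤ C) (t : ℕ) :
    ∑ t' ∈ S.filter (fun t' => t' ≤ t + 1), tx t' ≤
      C + ∑ t' ∈ S.filter (fun t' => t' ≤ t - F), tx t' := by
  have hmono := sum_filter_snd_mono (fun e he => (h.2.1 e he).2)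
    (P := fun e => decide (e.1 + F < t + 1)) (Q := fun e => decide (e.1 ≤ t - F))
    (fun e he => by simp only [decide_eq_true_eq] at he ⊢; omega)
  linarith [h.settled_le hC (t + 1), h.2.2.1 (t - F)]

theorem PFeasible.flush_le (h : PFeasible F C n tx S L) (hC : 0 ≤ C)
    {e : ℕ × ℝ} (he : e ∈ L) : e.2 ≤ C := by
  have hadd := add_sum_filter_snd_le (fun e he => (h.2.1 e he).2)
    (P := fun x => decide (x.1 + F < e.1)) (Q := fun x => decide (x.1 ≤ e.1))
    (fun x hx => by simp only [decide_eq_true_eq] at hx ⊢; omega) he (by simp) (by simp)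
  linarith [h.settled_le hC e.1, h.2.2.1 e.1]

theorem PFeasible.settled_le_length (h : PFeasible F C n tx S L) (hC : 0 ≤ C) :
    ∑ t ∈ S, tx t ≤ C + C * L.length := by
  have hS : S.filter (fun t' => t' ≤ n) = S :=
    Finset.filter_true_of_mem fun x hx => (Finset.mem_Icc.1 (h.1 hx)).2
  have hle := h.settled_le hC n
  rw [hS] at hle
  have hmono := sum_filter_snd_mono (fun e he => (h.2.1 e he).2)
    (P := fun e => decide (e.1 + F < n)) (Q := fun _ => true) (by simp)
  have hcard := List.sum_le_card_nsmul (L.map Prod.snd) C (by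
    simp only [List.mem_map, forall_exists_index, and_imp]
    rintro _ e he rfl
    exact h.flush_le hC he)
  rw [List.filter_true] at hmono
  simp only [List.length_map, nsmul_eq_mul] at hcard
  linarith

theorem sum_filter_le_succ (m : ℕ) (hnn : 0 ≤ tx (m + 1)) :
    ∑ t ∈ S.filter (fun t => t ≤ m + 1), tx t ≤
      ∑ t ∈ S.filter (fun t => t ≤ m), tx t + tx (m + 1) := by
  have hsub : S.filter (fun t => t ≤ m + 1) ⊆ insert (m + 1) (S.filter (fun t => t ≤ m)) := by
    intro x
    simp only [Finset.mem_filter, Finset.mem_insert]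
    rintro ⟨hx, hxm⟩
    by_cases h : x = m + 1
    · exact Or.inl h
    · exact Or.inr ⟨hx, by omega⟩
  have hnot : m + 1 ∉ S.filter (fun t => t ≤ m) := by simp
  rw [add_comm (∑ t ∈ _, tx t), ← Finset.sum_insert hnot]
  refine Finset.sum_le_sum_of_subset_of_nonneg hsub fun x hx hnx => ?_
  simp only [Finset.mem_filter, Finset.mem_insert] at hx hnx
  rcases hx with rfl | hx
  · exact hnn
  · exact absurd ⟨hx.1, by omega⟩ hnx

/-- The value settled by any feasible execution is at most `1 / (1 - T / C - η)` times the
value settled by the threshold algorithm, on every prefix of the transaction sequence. -/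
theorem PFeasible.mul_settled_le_VEta (h : PFeasible F C n tx S L) {T η : ℝ} (hC : 0 < C)
    (hT : 0 ≤ T) (hη : 0 < η) (hTη : T / C ≤ η) (hη1 : 0 < 1 - T / C - η)
    (htx : ∀ t ∈ Finset.Icc 1 n, 0 ≤ tx t ∧ tx t ≤ T) {m : ℕ} (hm : m ≤ n) :
    (1 - T / C - η) * ∑ t ∈ S.filter (fun t => t ≤ m), tx t ≤ VEta C η F m tx := by
  induction m using Nat.strong_induction_on with
  | _ m ih =>
  rcases m with _ | m
  · have hempty : S.filter (fun t => t ≤ 0) = ∅ := by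
      refine Finset.filter_false_of_mem fun x hx => ?_
      have := (Finset.mem_Icc.1 (h.1 hx)).1
      omega
    rw [hempty]
    simp [VEta, etaRun_zero]
  · obtain ⟨hv0, hvT⟩ := htx (m + 1) (Finset.mem_Icc.2 ⟨by omega, hm⟩)
    rcases VEta_succ C η F tx m with hs | ⟨hs, hd⟩
    · have hle1 : 1 - T / C - η ≤ 1 := by
        have : 0 ≤ T / C := by positivity
        linarith
      have hO := mul_le_mul_of_nonneg_left (sum_filter_le_succ (S := S) m hv0) hη1.le
      have hprev := ih m (by omega) (by omega)
      have hv := mul_le_of_le_one_left hv0 hle1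
      rw [hs]
      linarith
    · have hprev := ih (m - F) (by omega) (by omega)
      have hO := mul_le_mul_of_nonneg_left (h.settled_window_le hC.le m) hη1.le
      have hR := (etaRun_committed_mem F (m := m - F) (by positivity) ((div_le_iff₀ hC).1 hTη)
        htx (by omega)).2
      have hRV := etaRun_committed_add C η F tx (m - F)
      have hK : (1 - T / C - η) * C = C - T - η * C := by field_simp
      rw [hs]
      linarith

theorem PFeasible.profit_le (h : PFeasible F C n tx S L) {p τ : ℝ} (hC : 0 < C) (hp : 0 < p)
    (hτ : 0 ≤ τ) :
    PProfit p τ tx S L ≤ p * (1 - τ / (p * C)) * ∑ t ∈ S, tx t + τ := by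
  have hlen := mul_le_mul_of_nonneg_left (h.settled_le_length hC.le) (div_nonneg hτ hC.le)
  have h1 : τ / C * (C + C * L.length) = τ + τ * L.length := by field_simp
  have h2 : p * (1 - τ / (p * C)) = p - τ / C := by field_simp
  rw [h2, sub_mul]
  unfold PProfit
  linarith

end Feasible

theorem mul_VEta_le_profit {C η T p τ : ℝ} (F : ℕ) {tx : ℕ → ℝ} {n : ℕ} (hC : 0 < C)
    (hp : 0 < p) (hτ : 0 ≤ τ) (hη : 0 < η) (hTη : T / C ≤ η)
    (htx : ∀ t ∈ Finset.Icc 1 n, 0 ≤ tx t ∧ tx t ≤ T) :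
    p * (1 - τ / (p * C) / η) * VEta C η F n tx ≤
      p * VEta C η F n tx - τ * (fEta C η F n tx : ℝ) := by
  have hR := (etaRun_committed_mem F (m := n) (by positivity) ((div_le_iff₀ hC).1 hTη)
    htx le_rfl).1
  have hRV := etaRun_committed_add C η F tx n
  have hf : η * C * fEta C η F n tx ≤ VEta C η F n tx := by linarith
  have hmul := mul_le_mul_of_nonneg_left hf (show 0 ≤ τ / (η * C) by positivity)
  have h1 : τ / (η * C) * (η * C * fEta C η F n tx) = τ * fEta C η F n tx := by field_simp
  have h2 : p * (1 - τ / (p * C) / η) = p - τ / (η * C) := by field_simp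
  rw [h2, sub_mul]
  linarith

/-- Competitive ratio of `A_η` at the optimal threshold
`η* = √(β(1 − T/C))` with `β = τ/(pC)`: every feasible execution in the profit model
achieves profit at most
`((1 − β)/(√(1 − T/C) − √β)²) · (p·V_{A_{η*}}(tx) − τ·f_{A_{η*}}(tx)) + c₀`. -/
theorem eta_star_competitive (C T p τ : ℝ) (F : ℕ)
    (hC : 0 < C) (hT : 0 ≤ T) (hF : 1 ≤ F)
    (hp0 : 0 < p) (hp1 : p < 1) (hτ : 0 < τ)
    (hβ : τ / (p * C) < 1 - T / C)
    (hη : T / C ≤ Real.sqrt ((τ / (p * C)) * (1 - T / C))) :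
    ∃ c₀ : ℝ, 0 ≤ c₀ ∧ ∀ (n : ℕ) (tx : ℕ → ℝ),
      (∀ t ∈ Finset.Icc 1 n, 0 ≤ tx t ∧ tx t ≤ T) →
      ∀ (S : Finset ℕ) (L : List (ℕ × ℝ)), PFeasible F C n tx S L →
        PProfit p τ tx S L ≤
          ((1 - τ / (p * C)) /
              (Real.sqrt (1 - T / C) - Real.sqrt (τ / (p * C))) ^ 2) *
            (p * VEta C (Real.sqrt ((τ / (p * C)) * (1 - T / C))) F n tx
              - τ * (fEta C (Real.sqrt ((τ / (p * C)) * (1 - T / C))) F n tx : ℝ))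
          + c₀ := by
  have hβ0 : 0 < τ / (p * C) := by positivity
  have hα0 : 0 ≤ T / C := by positivity
  set β := τ / (p * C) with hβdef
  set η := √(β * (1 - T / C)) with hηdef
  have hα1 : 0 < 1 - T / C := hβ0.trans hβ
  have hη0 : 0 < η := Real.sqrt_pos.2 (mul_pos hβ0 hα1)
  have hηsq : η ^ 2 = β * (1 - T / C) := Real.sq_sqrt (mul_pos hβ0 hα1).le
  have hβη : β < η := by nlinarith
  have hηα : 0 < 1 - T / C - η := by nlinarith
  have hden : (√(1 - T / C) - √β) ^ 2 = (1 - T / C - η) * (1 - β / η) := by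
    have hprod : √(1 - T / C) * √β = η := by
      rw [hηdef, mul_comm β, Real.sqrt_mul hα1.le]
    have hdiv : β / η * (1 - T / C) = η := by
      rw [div_mul_eq_mul_div, ← hηsq, sq, mul_self_div_self]
    have hcancel : β / η * η = β := div_mul_cancel₀ _ hη0.ne'
    rw [sub_sq, Real.sq_sqrt hα1.le, Real.sq_sqrt hβ0.le]
    linear_combination -2 * hprod + hdiv - hcancel
  have hβη1 : 0 < 1 - β / η := sub_pos.2 ((div_lt_one hη0).2 hβη)
  refine ⟨τ, hτ.le, fun n tx htx S L h => (h.profit_le hC hp0 hτ.le).trans ?_⟩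
  refine add_le_add_left ?_ τ
  have hS : S.filter (fun t => t ≤ n) = S :=
    Finset.filter_true_of_mem fun x hx => (Finset.mem_Icc.1 (h.1 hx)).2
  have hV := h.mul_settled_le_VEta hC hT hη0 hη hηα htx le_rfl
  rw [hS] at hV
  have hA := mul_VEta_le_profit F (n := n) hC hp0 hτ.le hη0 hη htx
  rw [← hβdef] at hA ⊢
  have hβ1 : 0 ≤ 1 - β := by linarith
  rw [hden, div_mul_eq_mul_div, le_div_iff₀ (mul_pos hηα hβη1)]
  calc p * (1 - β) * (∑ t ∈ S, tx t) * ((1 - T / C - η) * (1 - β / η))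
      = (1 - β) * (p * (1 - β / η) * ((1 - T / C - η) * ∑ t ∈ S, tx t)) := by ring
    _ ≤ (1 - β) * (p * (1 - β / η) * VEta C η F n tx) := by gcongr
    _ ≤ _ := by gcongr
end

section
/- (Optimal number of wallets.) Let C, T > 0 be reals and define g(x) = (x+1)/(x(1 − xT/C)) for x ∈ (0, C/T). Then x* = √(1 + C/T) − 1 satisfies 0 < x* < C/T, and for every x ∈ (0, C/T), g(x*) ≤ g(x); that is, x* minimizes the competitive ratio (x+1)/(x(1 − xT/C)) of FlushWhenFull over the number of wallets x. -/
open Finset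

/-- Optimal number of wallets: `x* = √(1 + C/T) − 1` lies in
`(0, C/T)` and minimizes the competitive ratio `g(x) = (x+1)/(x(1 − xT/C))` of
`FlushWhenFull` over `x ∈ (0, C/T)`. -/
theorem optimal_wallet_number (C T : ℝ) (hC : 0 < C) (hT : 0 < T) :
    (0 < Real.sqrt (1 + C / T) - 1 ∧ Real.sqrt (1 + C / T) - 1 < C / T) ∧
    ∀ x : ℝ, 0 < x → x < C / T →
      ((Real.sqrt (1 + C / T) - 1) + 1) /
          ((Real.sqrt (1 + C / T) - 1) * (1 - (Real.sqrt (1 + C / T) - 1) * T / C)) ≤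
        (x + 1) / (x * (1 - x * T / C)) := by
  obtain ⟨r, hr⟩ : ∃ r, r = C / T := ⟨_, rfl⟩
  have hr0 : 0 < r := hr ▸ div_pos hC hT
  have hmul : ∀ y : ℝ, y * T / C = y / r := fun y => by
    rw [hr]; field_simp
  simp only [hmul, ← hr]
  obtain ⟨s, hs⟩ : ∃ s, s = √(1 + r) := ⟨_, rfl⟩
  have hsq : s ^ 2 = 1 + r := hs ▸ Real.sq_sqrt (by linarith)
  have hs1 : 1 < s := hs ▸ Real.lt_sqrt_of_sq_lt (by linarith)
  obtain rfl : r = s ^ 2 - 1 := by linarith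
  rw [← hs]
  refine ⟨⟨by linarith, by nlinarith⟩, fun x hx hxr => ?_⟩
  have hopt : (s - 1 + 1) / ((s - 1) * (1 - (s - 1) / (s ^ 2 - 1))) = (s + 1) / (s - 1) := by
    have h1 : s - 1 ≠ 0 := by linarith
    have h2 : s + 1 ≠ 0 := by linarith
    have h3 : s ≠ 0 := by linarith
    have h4 : 1 - (s - 1) / (s ^ 2 - 1) = s / (s + 1) := by
      rw [show s ^ 2 - 1 = (s - 1) * (s + 1) by ring]
      field_simp
      ring
    rw [h4]
    field_simp
    ring
  have hden : 0 < x * (1 - x / (s ^ 2 - 1)) :=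
    mul_pos hx (sub_pos.2 ((div_lt_one hr0).2 hxr))
  rw [hopt, div_le_div_iff₀ (by linarith) hden, ← sub_nonneg]
  have hgap : (x + 1) * (s - 1) - (s + 1) * (x * (1 - x / (s ^ 2 - 1))) =
      (s + 1) * (x - (s - 1)) ^ 2 / (s ^ 2 - 1) := by
    have := hr0.ne'
    field_simp
    ring
  rw [hgap]
  exact div_nonneg (mul_nonneg (by linarith) (sq_nonneg _)) hr0.le
end

section
/- (Optimality of the threshold η* = √(β(1−s)).) Let s ∈ [0,1) and β ∈ (0, 1−s) be reals, and define h(η) = (1−β)/((1 − s − η)(1 − β/η)) for η ∈ (β, 1−s). Then η* = √(β(1−s)) satisfies β < η* < 1 − s, h(η*) = (1−β)/((√(1−s) − √β)²), and h(η) ≥ h(η*) for every η ∈ (β, 1−s). -/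
open Finset

theorem sub_mul_one_sub_div_eq {a b : ℝ} (x : ℝ) (hx : x ≠ 0) :
    (a ^ 2 - x) * (1 - b ^ 2 / x) = (a - b) ^ 2 - (x - a * b) ^ 2 / x := by
  field_simp
  ring

/-- Optimality of the threshold `η* = √(β(1 − s))`: for `s ∈ [0,1)`
and `β ∈ (0, 1−s)`, `η*` lies in `(β, 1−s)`, `h(η*) = (1−β)/((√(1−s) − √β)²)`, and
`h(η) ≥ h(η*)` for every `η ∈ (β, 1−s)`, where
`h(η) = (1−β)/((1 − s − η)(1 − β/η))`. -/
theorem optimal_eta (s β : ℝ) (hs0 : 0 ≤ s) (hs1 : s < 1)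
    (hβ0 : 0 < β) (hβ1 : β < 1 - s) :
    (β < Real.sqrt (β * (1 - s)) ∧ Real.sqrt (β * (1 - s)) < 1 - s) ∧
    (1 - β) /
        ((1 - s - Real.sqrt (β * (1 - s))) * (1 - β / Real.sqrt (β * (1 - s)))) =
      (1 - β) / (Real.sqrt (1 - s) - Real.sqrt β) ^ 2 ∧
    ∀ η : ℝ, β < η → η < 1 - s →
      (1 - β) /
          ((1 - s - Real.sqrt (β * (1 - s))) * (1 - β / Real.sqrt (β * (1 - s)))) ≤
        (1 - β) / ((1 - s - η) * (1 - β / η)) := by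
  obtain ⟨a, b, ha, hb, hb0, rfl⟩ :
      ∃ a b : ℝ, 1 - s = a ^ 2 ∧ b < a ∧ 0 < b ∧ β = b ^ 2 :=
    ⟨√(1 - s), √β, (Real.sq_sqrt (by linarith)).symm, Real.sqrt_lt_sqrt hβ0.le hβ1,
      Real.sqrt_pos.2 hβ0, (Real.sq_sqrt hβ0.le).symm⟩
  have ha0 : 0 < a := hb0.trans hb
  have hab : 0 < b * a := mul_pos hb0 ha0
  rw [ha, ← mul_pow, Real.sqrt_sq hab.le, Real.sqrt_sq ha0.le, Real.sqrt_sq hb0.le]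
  have hopt : (a ^ 2 - b * a) * (1 - b ^ 2 / (b * a)) = (a - b) ^ 2 := by
    rw [sub_mul_one_sub_div_eq _ hab.ne', mul_comm b a]
    simp
  rw [hopt]
  refine ⟨⟨by nlinarith, by nlinarith⟩, rfl, fun η h₁ h₂ ↦ ?_⟩
  have hη : 0 < η := hβ0.trans h₁
  refine div_le_div_of_nonneg_left (by linarith) ?_ ?_
  · exact mul_pos (sub_pos.2 h₂) (sub_pos.2 ((div_lt_one hη).2 h₁))
  · rw [sub_mul_one_sub_div_eq _ hη.ne']
    exact sub_le_self _ (by positivity)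
end

section
/- (FlushWhenFull is not competitive when the maximum transaction size equals the wallet size.) Let C > 0 be a real, k ≥ 2 an integer, F ≥ 1 an integer flush period, and let the maximum transaction size be T = C/k (so r = kT/C = 1). Then for all constants α ≥ 1 and c ≥ 0, there exist an n and a transaction sequence tx of length n with values in [0, C/k] such that OPT_D(C,k;tx) > α · V_FWF(tx) + c. -/
open Finset

/-- The periodic transaction sequence with period `F + 2` whose periods read
`ε, W, 0, …, 0`. -/
def smallFullTx (F : ℕ) (ε W : ℝ) (t : ℕ) : ℝ :=
  if t % (F + 2) = 1 then ε else if t % (F + 2) = 2 then W else 0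

lemma smallFullTx_one {F : ℕ} (hF : 1 ≤ F) (ε W : ℝ) (m : ℕ) :
    smallFullTx F ε W (m * (F + 2) + 1) = ε := by
  simp [smallFullTx, Nat.mul_add_mod_self_right, Nat.mod_eq_of_lt (by omega : 1 < F + 2)]

lemma smallFullTx_of_mod_eq_two {F : ℕ} (ε W : ℝ) {t : ℕ} (ht : t % (F + 2) = 2) :
    smallFullTx F ε W t = W := by
  simp [smallFullTx, ht]

lemma add_two_mod_period {F : ℕ} (hF : 1 ≤ F) (m : ℕ) : (m * (F + 2) + 2) % (F + 2) = 2 := by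
  rw [Nat.mul_add_mod_self_right, Nat.mod_eq_of_lt (by omega)]

lemma smallFullTx_rest {F : ℕ} (ε W : ℝ) (m : ℕ) {i : ℕ} (hi : 3 ≤ i) (hi' : i ≤ F + 2) :
    smallFullTx F ε W (m * (F + 2) + i) = 0 := by
  rw [smallFullTx, Nat.mul_add_mod_self_right]
  rcases hi'.eq_or_lt with rfl | h
  · simp
  · rw [Nat.mod_eq_of_lt h, if_neg (by omega), if_neg (by omega)]

lemma fwfRun_succ (C : ℝ) (k F n : ℕ) (tx : ℕ → ℝ) :
    fwfRun C k F (n + 1) tx = fwfStep C k F (fwfRun C k F n tx) (n + 1) (tx (n + 1)) := by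
  simp [fwfRun, List.range_succ]

/-- A state of `FlushWhenFull` with a fresh active wallet, all wallets online after time `D`, and
settled value `V`. -/
def FWFState.IsFresh (st : FWFState) (W : ℝ) (D : ℕ) (V : ℝ) : Prop :=
  st.cap = W ∧ st.settled = V ∧ ∀ j, st.offlineUntil j ≤ D

lemma FWFState.IsFresh.step_zero {C : ℝ} {k F D : ℕ} {V : ℝ} {st : FWFState}
    (h : st.IsFresh (C / k) D V) (hW : 0 ≤ C / k) (t : ℕ) :
    (fwfStep C k F st t 0).IsFresh (C / k) D V := by
  obtain ⟨hcap, hset, hoff⟩ := h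
  unfold fwfStep
  split_ifs with h1 h2
  · exact ⟨hcap, hset, hoff⟩
  · exact ⟨by simpa using hcap, by simpa using hset, hoff⟩
  · exact absurd (hcap ▸ hW) h2

lemma FWFState.IsFresh.step_small_full {C ε V : ℝ} {k F D : ℕ} {st : FWFState}
    (h : st.IsFresh (C / k) D V) (hε : 0 < ε) (hεW : ε ≤ C / k) :
    (fwfStep C k F (fwfStep C k F st (D + 1) ε) (D + 2) (C / k)).IsFresh
      (C / k) (D + (F + 2)) (V + ε) := by
  obtain ⟨hcap, hset, hoff⟩ := h
  have h1 : ¬ D + 1 ≤ st.offlineUntil (st.active % k) := by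
    have := hoff (st.active % k); omega
  have h2 : ¬ D + 2 ≤ st.offlineUntil (st.active % k) := by omega
  have h3 : ¬ C / k ≤ st.cap - ε := by rw [hcap]; linarith
  have hstep : fwfStep C k F st (D + 1) ε =
      { st with cap := st.cap - ε, settled := st.settled + ε } := by
    rw [fwfStep, if_neg h1, if_pos (hcap ▸ hεW)]
  rw [hstep, fwfStep, if_neg h2, if_neg h3]
  refine ⟨rfl, by simp [hset], fun j => ?_⟩
  have := hoff j
  dsimp only
  split_ifs <;> omega

lemma fwfRun_smallFullTx_isFresh {C ε : ℝ} {k F : ℕ} (hF : 1 ≤ F) (hε : 0 < ε) (hεW : ε ≤ C / k)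
    (m : ℕ) :
    (fwfRun C k F (m * (F + 2)) (smallFullTx F ε (C / k))).IsFresh
      (C / k) (m * (F + 2)) (m * ε) := by
  induction m with
  | zero => simp [fwfRun, FWFState.IsFresh]
  | succ m ih =>
    have hperiod : ∀ i, i ≤ F →
        (fwfRun C k F (m * (F + 2) + (i + 2)) (smallFullTx F ε (C / k))).IsFresh
          (C / k) (m * (F + 2) + (F + 2)) (m * ε + ε) := by
      intro i
      induction i with
      | zero =>
        intro _
        have h := ih.step_small_full (F := F) hε hεW
        rw [zero_add, fwfRun_succ, fwfRun_succ, smallFullTx_one hF,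
          smallFullTx_of_mod_eq_two _ _ (add_two_mod_period hF m)]
        exact h
      | succ i ihi =>
        intro hi
        rw [show m * (F + 2) + (i + 1 + 2) = m * (F + 2) + (i + 2) + 1 by ring, fwfRun_succ,
          add_assoc _ (i + 2) 1, smallFullTx_rest _ _ _ (by omega) (by omega)]
        exact (ihi (by omega)).step_zero (hε.le.trans hεW) _
    have h := hperiod F le_rfl
    rw [Nat.succ_mul]
    push_cast
    rwa [add_one_mul]

/-- The times `2, F + 4, 2F + 6, …` up to `n`. -/
def fullTimes (F n : ℕ) : Finset ℕ := (Finset.Icc 1 n).filter (fun t => t % (F + 2) = 2)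

/-- Wallet `0` settles exactly the transactions in `fullTimes F n`. -/
def fullAssignment (F n t : ℕ) : Option ℕ := if t ∈ fullTimes F n then some 0 else none

lemma fullAssignment_eq_some {F n t i : ℕ} (h : fullAssignment F n t = some i) :
    t ∈ fullTimes F n ∧ i = 0 := by
  unfold fullAssignment at h
  split_ifs at h with ht
  exact ⟨ht, by simpa using h.symm⟩

lemma dFeasible_fullAssignment {C : ℝ} {k F : ℕ} (hk : 0 < k) (hC : 0 ≤ C / k) (ε : ℝ) (n : ℕ) :
    DFeasible F C k n (smallFullTx F ε (C / k)) (fullAssignment F n)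
      (fun _ => fullTimes F n) := by
  refine ⟨fun _ => Finset.filter_subset _ _, fun t i h => ?_, fun t i h => ⟨?_, ?_⟩⟩
  · obtain ⟨ht, rfl⟩ := fullAssignment_eq_some h
    exact ⟨hk, Finset.mem_of_mem_filter t ht⟩
  · rintro ⟨t', ht', hlt, hle⟩
    have h1 : t % (F + 2) = 2 := (Finset.mem_filter.1 (fullAssignment_eq_some h).1).2
    have h2 : t' % (F + 2) = 2 := (Finset.mem_filter.1 ht').2
    have hdvd : F + 2 ∣ t - t' := (Nat.modEq_iff_dvd' hlt.le).1 (h2.trans h1.symm)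
    have := Nat.le_of_dvd (by omega) hdvd
    omega
  · have h1 : t % (F + 2) = 2 := (Finset.mem_filter.1 (fullAssignment_eq_some h).1).2
    have hW := smallFullTx_of_mod_eq_two ε (C / k) h1
    have hsub : (Finset.Icc 1 t).filter (fun t' => fullAssignment F n t' = some i ∧
        ∀ u ∈ fullTimes F n, ¬ (t' ≤ u ∧ u < t)) ⊆ {t} := by
      intro t' ht'
      obtain ⟨hmem, hs, hu⟩ := Finset.mem_filter.1 ht'
      have := hu t' (fullAssignment_eq_some hs).1
      have := (Finset.mem_Icc.1 hmem).2
      rw [Finset.mem_singleton]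
      omega
    refine (Finset.sum_le_sum_of_subset_of_nonneg hsub fun x hx _ => ?_).trans ?_
    · rw [Finset.mem_singleton.1 hx, hW]; exact hC
    · rw [Finset.sum_singleton, hW]

lemma le_card_fullTimes {F : ℕ} (hF : 1 ≤ F) (N : ℕ) : N ≤ (fullTimes F (N * (F + 2))).card := by
  have hinj : Function.Injective fun m : ℕ => m * (F + 2) + 2 := fun a b hab => by
    simpa using hab
  calc N = ((Finset.range N).image fun m => m * (F + 2) + 2).card := by
        rw [Finset.card_image_of_injective _ hinj, Finset.card_range]
    _ ≤ _ := by
        refine Finset.card_le_card fun t ht => ?_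
        obtain ⟨m, hm, rfl⟩ := Finset.mem_image.1 ht
        have hle := Nat.mul_le_mul_right (F + 2) (Nat.succ_le_of_lt (Finset.mem_range.1 hm))
        rw [Nat.succ_mul] at hle
        exact Finset.mem_filter.2
          ⟨Finset.mem_Icc.2 ⟨by omega, by omega⟩, add_two_mod_period hF m⟩

lemma dValue_fullAssignment {F : ℕ} (ε W : ℝ) (n : ℕ) :
    DValue n (smallFullTx F ε W) (fullAssignment F n) = (fullTimes F n).card * W := by
  have hset : (Finset.Icc 1 n).filter (fun t => (fullAssignment F n t).isSome) =
      fullTimes F n := by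
    ext t
    simp +contextual [fullAssignment, fullTimes]
  have hsum : ∀ t ∈ fullTimes F n, smallFullTx F ε W t = W := fun t ht =>
    smallFullTx_of_mod_eq_two ε W (Finset.mem_filter.1 ht).2
  rw [DValue, hset, Finset.sum_congr rfl hsum, Finset.sum_const, nsmul_eq_mul]

/-- `FlushWhenFull` is not competitive when the maximum transaction
size equals the wallet size `C / k`: for all constants `α ≥ 1` and `c ≥ 0` there is a
transaction sequence with values in `[0, C/k]` and a feasible execution whose value
exceeds `α · V_FWF(tx) + c`. -/
theorem fwf_not_competitive (C : ℝ) (k F : ℕ)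
    (hC : 0 < C) (hk : 2 ≤ k) (hF : 1 ≤ F) :
    ∀ α c : ℝ, 1 ≤ α → 0 ≤ c →
      ∃ (n : ℕ) (tx : ℕ → ℝ),
        (∀ t ∈ Finset.Icc 1 n, 0 ≤ tx t ∧ tx t ≤ C / k) ∧
        ∃ (s : ℕ → Option ℕ) (Φ : ℕ → Finset ℕ), DFeasible F C k n tx s Φ ∧
          DValue n tx s > α * VFWF C k F n tx + c := by
  intro α c hα _
  have hW : 0 < C / k := div_pos hC (by exact_mod_cast (by omega : 0 < k))
  obtain ⟨N, hN⟩ := exists_nat_gt (2 * c / (C / k))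
  rw [div_lt_iff₀ hW] at hN
  set ε : ℝ := C / k / (2 * α) with hεdef
  have hε : 0 < ε := by positivity
  have hεW : ε ≤ C / k := div_le_self hW.le (by linarith)
  refine ⟨N * (F + 2), smallFullTx F ε (C / k), fun t _ => ?_, fullAssignment F _,
    fun _ => fullTimes F _, dFeasible_fullAssignment (by omega) hW.le ε _, ?_⟩
  · unfold smallFullTx
    split_ifs
    exacts [⟨hε.le, hεW⟩, ⟨hW.le, le_rfl⟩, ⟨le_rfl, hW.le⟩]
  · have hV : VFWF C k F (N * (F + 2)) (smallFullTx F ε (C / k)) = N * ε :=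
      (fwfRun_smallFullTx_isFresh hF hε hεW N).2.1
    have hcard : (N : ℝ) * (C / k) ≤ (fullTimes F (N * (F + 2))).card * (C / k) :=
      mul_le_mul_of_nonneg_right (by exact_mod_cast le_card_fullTimes hF N) hW.le
    have hαε : α * (N * ε) = N * (C / k) / 2 := by
      rw [hεdef]; field_simp
    rw [dValue_fullAssignment, hV, hαε]
    linarith
end

section
/- (Two-wallet FlushAll is 2-competitive against a one-wallet optimum of the same wallet size.) Let F ≥ 1 be an integer flush period and let the wallet size and maximum transaction size both equal 1. Then there is a constant c₀ ≥ 0 depending only on F such that for every n and every transaction sequence tx of length n with values in [0,1], OPT_D(1,1;tx) ≤ 2 · V_FA(tx) + c₀, where FlushAll is run with k = 2 wallets and total collateral C = 2 (so each of its two wallets has size 1), and OPT_D(1,1;tx) is the optimum of the discrete 1-wallet model with collateral 1. -/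
open Finset

theorem DValue_succ_le {n m : ℕ} {tx : ℕ → ℝ} (s : ℕ → Option ℕ) (hm : m + 1 ≤ n)
    (htx : ∀ t ∈ Finset.Icc 1 n, 0 ≤ tx t) :
    DValue (m + 1) tx s ≤ DValue m tx s + tx (m + 1) := by
  have h0 := htx (m + 1) (Finset.mem_Icc.2 ⟨by omega, hm⟩)
  unfold DValue
  rw [Finset.sum_filter, Finset.sum_filter, Finset.sum_Icc_succ_top (by omega)]
  gcongr
  split_ifs <;> linarith

/-- A single wallet of size `1` settles at most `1` within any `F + 1` consecutive slots. -/
theorem DValue_le_add_one_of_le {F n p m : ℕ} {tx : ℕ → ℝ} {s : ℕ → Option ℕ}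
    {Φ : ℕ → Finset ℕ} (hfeas : DFeasible F 1 1 n tx s Φ) (htx : ∀ t ∈ Finset.Icc 1 n, 0 ≤ tx t)
    (hpm : p ≤ m) (hmp : m ≤ p + 1 + F) (hmn : m ≤ n) :
    DValue m tx s ≤ DValue p tx s + 1 := by
  obtain ⟨-, hs, hcap⟩ := hfeas
  have hzero : ∀ t, (s t).isSome → s t = some 0 := by
    intro t ht
    obtain ⟨i, hi⟩ := Option.isSome_iff_exists.1 ht
    have := (hs t i hi).1
    rw [hi, show i = 0 by omega]
  set A := (Finset.Icc 1 m).filter (fun t => (s t).isSome)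
  set W := A.filter (fun t => p < t) with hW
  have hWle : ∑ t ∈ W, tx t ≤ 1 := by
    rcases W.eq_empty_or_nonempty with hE | hne
    · simp [hE]
    · obtain ⟨t, htW, hmax⟩ := W.exists_max_image id hne
      have htm : ((1 ≤ t ∧ t ≤ m) ∧ (s t).isSome) ∧ p < t := by simpa [hW, A] using htW
      obtain ⟨hon, hsum⟩ := hcap t 0 (hzero t htm.1.2)
      refine le_trans (Finset.sum_le_sum_of_subset_of_nonneg ?_ ?_) (hsum.trans (by norm_num))
      · intro r hr
        have hrt : r ≤ t := hmax r hr
        have hrm : ((1 ≤ r ∧ r ≤ m) ∧ (s r).isSome) ∧ p < r := by simpa [hW, A] using hr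
        refine Finset.mem_filter.2 ⟨Finset.mem_Icc.2 ⟨hrm.1.1.1, hrt⟩, hzero r hrm.1.2, ?_⟩
        exact fun u hu hur => hon ⟨u, hu, hur.2, by omega⟩
      · intro r hr _
        have := Finset.mem_Icc.1 (Finset.mem_filter.1 hr).1
        exact htx r (Finset.mem_Icc.2 ⟨this.1, by omega⟩)
  have hrest : ∑ t ∈ A.filter (fun t => ¬ p < t), tx t ≤ DValue p tx s := by
    refine Finset.sum_le_sum_of_subset_of_nonneg ?_ ?_
    · intro r hr
      simp only [A, Finset.mem_filter, Finset.mem_Icc] at hr ⊢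
      exact ⟨⟨hr.1.1.1, by omega⟩, hr.1.2⟩
    · intro r hr _
      have := Finset.mem_Icc.1 (Finset.mem_filter.1 hr).1
      exact htx r (Finset.mem_Icc.2 ⟨this.1, by omega⟩)
  have := Finset.sum_filter_add_sum_filter_not A (fun t => p < t) tx
  change ∑ t ∈ A, tx t ≤ _
  linarith

/-- The potential invariant of two-wallet `FlushAll` against a one-wallet execution `s`.
Offline, the value of `s` before the last flush is smaller by `1` than twice the value of
`FlushAll`; online, the value of `s` is at most twice the value of `FlushAll`, minus the value
`2 - cap 0 - cap 1` settled since the wallets were last full. -/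
def FlushAllInvariant (F m : ℕ) (tx : ℕ → ℝ) (s : ℕ → Option ℕ) (st : FAState) : Prop :=
  (m < st.offlineUntil ∧ st.cap 0 = 1 ∧ st.cap 1 = 1 ∧
    ∃ p, st.offlineUntil = p + 1 + F ∧ p + 1 ≤ m ∧ DValue p tx s + 1 ≤ 2 * st.settled) ∨
  (st.offlineUntil ≤ m ∧ st.cap 0 ≤ 1 ∧ st.cap 1 ≤ 1 ∧
    (st.cap 1 = 1 ∨ st.cap 0 + st.cap 1 < 1) ∧
    DValue m tx s ≤ 2 * st.settled - (2 - st.cap 0 - st.cap 1))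

theorem FlushAllInvariant.step {F n m : ℕ} {tx : ℕ → ℝ} {s : ℕ → Option ℕ}
    {Φ : ℕ → Finset ℕ} {st : FAState} (hF : 1 ≤ F) (hfeas : DFeasible F 1 1 n tx s Φ)
    (htx : ∀ t ∈ Finset.Icc 1 n, 0 ≤ tx t ∧ tx t ≤ 1) (hm : m + 1 ≤ n)
    (hst : FlushAllInvariant F m tx s st) :
    FlushAllInvariant F (m + 1) tx s (faStep 2 2 F st (m + 1) (tx (m + 1))) := by
  have htx0 := fun t ht => (htx t ht).1
  obtain ⟨hv0, hv1⟩ := htx (m + 1) (Finset.mem_Icc.2 ⟨by omega, hm⟩)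
  rcases hst with ⟨hlt, h0, h1, p, hp, hpm, hval⟩ | ⟨hle, h0, h1, hor, hval⟩
  · rw [faStep, if_pos (by omega)]
    rcases Nat.lt_or_ge (m + 1) st.offlineUntil with h | h
    · exact Or.inl ⟨h, h0, h1, p, hp, by omega, hval⟩
    · have := DValue_le_add_one_of_le (p := p) (m := m + 1) hfeas htx0 (by omega) (by omega) hm
      exact Or.inr ⟨h, h0.le, h1.le, Or.inl h1, by rw [h0, h1]; linarith⟩
  · have hsucc := DValue_succ_le s hm htx0
    rw [faStep, if_neg (by omega)]
    split_ifs with h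
    · right
      have hlt := (Nat.find_spec h).1
      have hfit := (Nat.find_spec h).2
      have hmin : ∀ j < Nat.find h, ¬ (j < 2 ∧ tx (m + 1) ≤ st.cap j) :=
        fun j hj => Nat.find_min h hj
      generalize Nat.find h = i at hlt hfit hmin
      interval_cases i
      · simp only [if_true, one_ne_zero, if_false]
        refine ⟨by omega, by linarith, h1, ?_, by linarith⟩
        rcases hor with hor | hor
        · exact Or.inl hor
        · right; linarith
      · have hc : st.cap 0 < tx (m + 1) := by simpa using hmin 0 one_pos
        simp only [if_true, zero_ne_one, if_false]
        exact ⟨by omega, h0, by linarith, Or.inr (by linarith), by linarith⟩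
    · left
      push Not at h
      have hc0 := h 0 (by norm_num)
      have hc1 := h 1 (by norm_num)
      refine ⟨show m + 1 < m + 1 + F by omega, by norm_num, by norm_num, m, rfl, le_rfl, ?_⟩
      change _ ≤ 2 * st.settled
      rcases hor with hor | hor <;> linarith

theorem flushAllInvariant_faRun {F n : ℕ} {tx : ℕ → ℝ} {s : ℕ → Option ℕ}
    {Φ : ℕ → Finset ℕ} (hF : 1 ≤ F) (hfeas : DFeasible F 1 1 n tx s Φ)
    (htx : ∀ t ∈ Finset.Icc 1 n, 0 ≤ tx t ∧ tx t ≤ 1) {m : ℕ} (hm : m ≤ n) :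
    FlushAllInvariant F m tx s (faRun 2 2 F m tx) := by
  induction m with
  | zero => right; norm_num [faRun, DValue]
  | succ m ih =>
    rw [faRun, List.range_succ, List.foldl_append]
    exact (ih (by omega)).step hF hfeas htx hm


/-- Two-wallet `FlushAll` (total collateral `2`, so each wallet has
size `1`) is 2-competitive against the optimum of the discrete 1-wallet model with
collateral `1`, when the maximum transaction size is `1`. -/
theorem two_wallet_flushAll_vs_one_wallet_opt (F : ℕ) (hF : 1 ≤ F) :
    ∃ c₀ : ℝ, 0 ≤ c₀ ∧ ∀ (n : ℕ) (tx : ℕ → ℝ),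
      (∀ t ∈ Finset.Icc 1 n, 0 ≤ tx t ∧ tx t ≤ 1) →
      ∀ (s : ℕ → Option ℕ) (Φ : ℕ → Finset ℕ), DFeasible F 1 1 n tx s Φ →
        DValue n tx s ≤ 2 * VFA 2 2 F n tx + c₀ := by
  refine ⟨0, le_rfl, fun n tx htx s Φ hfeas => ?_⟩
  change _ ≤ 2 * (faRun 2 2 F n tx).settled + 0
  rcases flushAllInvariant_faRun hF hfeas htx le_rfl with
    ⟨hlt, -, -, p, hp, hpm, hval⟩ | ⟨-, h0, h1, -, hval⟩
  · have := DValue_le_add_one_of_le (p := p) hfeas (fun t ht => (htx t ht).1)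
      (by omega) (by omega) le_rfl
    linarith
  · linarith
end
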